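/- arXiv:2010.02410 — 2 statements merged into one kernel-verified Lean document; each statement's English description precedes it below -/
import Mathlib

section
/- Let q > 2 be a prime power and 𝔽_q the finite field with q elements. Let t, n, d_1, …, d_t be positive integers with 1 ≤ n < (t−1)/2, d_1 > d_2 > ⋯ > d_t ≥ 2, and suppose char(𝔽_q) does not divide d_i for 1 ≤ i ≤ t. Let A = (a_{ij}) ∈ 𝔽_q^{n×t} satisfy hypothesis (H). Let c_{jl} (1 ≤ j, l ≤ n) be positive integers with c_{j1} + ⋯ + c_{jn} < d_t for every j, let a_1, …, a_n ∈ 𝔽_q with a_j ≠ 0 for at least one j, and let b_1, …, b_n ∈ 𝔽_q all be nonzero. Let N* be the number of tuples x = (x_1, …, x_t) ∈ (𝔽_q^*)^t (all coordinates nonzero) such that ∑_{l=1}^t a_{jl} x_l^{d_l} + a_j = b_j · x_1^{c_{j1}} ⋯ x_n^{c_{jn}} for every 1 ≤ j ≤ n. Then |N* − ∑_{i=0}^{t−2n−1} (−1)^i · C(t,i) · q^{t−n−i}| ≤ (15 n d_1)^{t+1} · q^{t/2}, where C(t,i) is the binomial coefficient (equivalently, the main term equals (q−1)^t/q^n − ∑_{i=t−2n}^{t}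 (−1)^i C(t,i) q^{t−n−i} as real numbers). -/
open Finset in
/-- A system `x_l ^ e_l = g_l(x)` with `deg g_l < e_l` has at most `∏ e_l` solutions. -/
theorem card_solutions_le_prod_of_totalDegree_lt {F σ : Type*} [Field F] [Finite F] [Fintype σ]
    (e : σ → ℕ) (g : σ → MvPolynomial σ F) (hg : ∀ l, (g l).totalDegree < e l)
    (Z : Finset (σ → F)) (hZ : ∀ x ∈ Z, ∀ l, x l ^ e l = MvPolynomial.eval x (g l)) :
    #Z ≤ ∏ l, e l := by
  classical
  have := Fintype.ofFinite F
  let b : (∀ l, Fin (e l)) → (Z → F) := fun s z => ∏ l, (z : σ → F) l ^ (s l : ℕ)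
  have hmon : ∀ N : ℕ, ∀ s : σ →₀ ℕ, s.degree = N →
      (fun z : Z => ∏ l, (z : σ → F) l ^ s l) ∈ Submodule.span F (Set.range b) := by
    intro N
    induction N using Nat.strong_induction_on with
    | _ N ih =>
      have hpoly : ∀ p : MvPolynomial σ F, (∀ s ∈ p.support, s.degree < N) →
          (fun z : Z => MvPolynomial.eval (z : σ → F) p) ∈ Submodule.span F (Set.range b) := by
        intro p hp
        have : (fun z : Z => MvPolynomial.eval (z : σ → F) p)
            = ∑ s ∈ p.support, p.coeff s • (fun z : Z => ∏ l, (z : σ → F) l ^ s l) := by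
          ext z
          simp [MvPolynomial.eval_eq']
        rw [this]
        exact Submodule.sum_mem _ fun s hs => Submodule.smul_mem _ _ (ih _ (hp s hs) s rfl)
      intro s hs
      by_cases h : ∀ l, s l < e l
      · exact Submodule.subset_span ⟨fun l => ⟨s l, h l⟩, rfl⟩
      · push Not at h
        obtain ⟨l, hl⟩ := h
        have hle : Finsupp.single l (e l) ≤ s := by simpa using hl
        obtain ⟨s', rfl⟩ := exists_add_of_le hle
        have hdeg : e l + s'.degree = N := by rw [← hs]; simp
        convert hpoly (g l * MvPolynomial.monomial s' 1) ?_ using 1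
        · ext z
          have hz := hZ z z.2 l
          simp only [Finsupp.coe_add, Pi.add_apply, pow_add, prod_mul_distrib, map_mul,
            MvPolynomial.eval_monomial, one_mul, ← hz, Finsupp.prod_pow]
          congr 1
          rw [prod_eq_single l]
          · simp
          · intro j _ hj
            simp [Finsupp.single_eq_of_ne hj]
          · simp
        · intro u hu
          have h1 := MvPolynomial.le_totalDegree hu
          have h2 := MvPolynomial.totalDegree_mul (g l) (MvPolynomial.monomial s' (1 : F))
          have h3 := MvPolynomial.totalDegree_monomial s' (one_ne_zero (α := F))
          have h4 : (u.sum fun _ e => e) = u.degree := rfl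
          have h5 : (s'.sum fun _ e => e) = s'.degree := rfl
          have := hg l
          omega
  have htop : Submodule.span F (Set.range b) = ⊤ := by
    rw [eq_top_iff]
    intro f _
    obtain ⟨p, -, hp⟩ : (fun x => if h : x ∈ Z then f ⟨x, h⟩ else 0) ∈ Submodule.map
        (MvPolynomial.evalₗ F σ) (MvPolynomial.restrictDegree σ F (Fintype.card F - 1)) := by
      rw [MvPolynomial.map_restrict_dom_evalₗ]
      trivial
    have : f = ∑ s ∈ p.support, p.coeff s • (fun z : Z => ∏ l, (z : σ → F) l ^ s l) := by
      ext z
      have := congrFun hp z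
      simp only [MvPolynomial.evalₗ_apply, z.2, dif_pos] at this
      simp [← this, MvPolynomial.eval_eq']
    rw [this]
    exact Submodule.sum_mem _ fun s _ => Submodule.smul_mem _ _ (hmon _ s rfl)
  have := finrank_range_le_card (R := F) b
  rw [Set.finrank, htop, finrank_top] at this
  simpa using this

open Finset in
/-- Orthogonality of additive characters on `J → F`. -/
theorem AddChar.sum_apply_dotProduct {F J : Type*} [Field F] [Fintype F] [DecidableEq F]
    [Fintype J] [DecidableEq J] {ψ : AddChar F ℂ} (hψ : ψ.IsPrimitive) (w : J → F) :
    ∑ u : J → F, ψ (u ⬝ᵥ w) = if w = 0 then (Fintype.card F : ℂ) ^ Fintype.card J else 0 := by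
  have h : ∀ u : J → F, ψ (u ⬝ᵥ w) = ∏ j, ψ (u j * w j) := fun u => by
    simp only [dotProduct]
    induction (univ : Finset J) using Finset.induction_on with
    | empty => simp
    | insert j s hj ih => rw [sum_insert hj, prod_insert hj, AddChar.map_add_eq_mul, ih]
  simp_rw [h]
  rw [← Fintype.piFinset_univ, ← prod_univ_sum (fun _ => univ) (fun j x => ψ (x * w j))]
  simp_rw [AddChar.sum_mulShift _ hψ]
  split_ifs with hw
  · simp [hw]
  · obtain ⟨j, hj⟩ := Function.ne_iff.1 hw
    exact prod_eq_zero (mem_univ j) (by simpa using hj)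

open Finset in
/-- Second moment of the exponential sums attached to a map with fibres of size at most `D`. -/
theorem AddChar.sum_norm_sq_sum_dotProduct_le {F J X : Type*} [Field F] [Fintype F]
    [DecidableEq F] [Fintype J] [DecidableEq J] [Fintype X] {ψ : AddChar F ℂ} (hψ : ψ.IsPrimitive)
    (G : X → J → F) (D : ℕ) (hG : ∀ w, #{x | G x = w} ≤ D) :
    ∑ u : J → F, ‖∑ x, ψ (u ⬝ᵥ G x)‖ ^ 2
      ≤ (Fintype.card F : ℝ) ^ Fintype.card J * (Fintype.card X * D) := by
  have key : ((∑ u : J → F, ‖∑ x, ψ (u ⬝ᵥ G x)‖ ^ 2 : ℝ) : ℂ)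
      = ((Fintype.card F : ℝ) ^ Fintype.card J * (∑ y, #{x | G x = G y} : ℕ) : ℝ) := by
    push_cast
    have h : ∀ u : J → F, (‖∑ x, ψ (u ⬝ᵥ G x)‖ : ℂ) ^ 2
        = ∑ y, ∑ x, ψ (u ⬝ᵥ (G x - G y)) := fun u => by
      rw [← Complex.mul_conj', map_sum, sum_mul_sum, sum_comm]
      simp_rw [← AddChar.map_neg_eq_conj, ← AddChar.map_add_eq_mul, dotProduct_sub, sub_eq_add_neg]
    simp_rw [h]
    rw [sum_comm, mul_sum]
    refine sum_congr rfl fun y _ => ?_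
    rw [sum_comm]
    simp_rw [AddChar.sum_apply_dotProduct hψ, sub_eq_zero]
    rw [← sum_filter, sum_const, nsmul_eq_mul, mul_comm]
  rw [Complex.ofReal_inj.1 key]
  gcongr
  have : ∑ y, #{x | G x = G y} ≤ Fintype.card X * D := by
    simpa using sum_le_card_nsmul univ (fun y => #{x | G x = G y}) D fun y _ => hG _
  exact_mod_cast this

theorem card_units_pow_eq_le {F : Type*} [Field F] [Fintype F] [DecidableEq F] {e : ℕ}
    (he : 0 < e) (w : F) : Finset.card {y : Fˣ | (y : F) ^ e = w} ≤ e := by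
  calc Finset.card {y : Fˣ | (y : F) ^ e = w}
      ≤ (Polynomial.nthRoots e w).toFinset.card := by
        refine Finset.card_le_card_of_injOn (fun y => (y : F)) ?_ Units.val_injective.injOn
        intro y hy
        simpa [Polynomial.mem_nthRoots he] using hy
    _ ≤ e := (Multiset.toFinset_card_le _).trans (Polynomial.card_nthRoots _ _)

open Finset in
/-- Square-root cancellation for the exponential sum of a nonzero multiple of `y ^ e`. -/
theorem AddChar.norm_sum_units_pow_le {F : Type*} [Field F] [Fintype F] [DecidableEq F]
    {ψ : AddChar F ℂ} (hψ : ψ.IsPrimitive) {e : ℕ} (he : 0 < e) {μ : F} (hμ : μ ≠ 0) :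
    ‖∑ y : Fˣ, ψ (μ * (y : F) ^ e)‖ ≤ e * √(Fintype.card F) := by
  let S : F → ℝ := fun ν => ‖∑ y : Fˣ, ψ (ν * (y : F) ^ e)‖ ^ 2
  have h1 : ∑ ν, S ν ≤ Fintype.card F * (Fintype.card Fˣ * e) := by
    have := AddChar.sum_norm_sq_sum_dotProduct_le (J := Unit) hψ
      (fun (y : Fˣ) (_ : Unit) => (y : F) ^ e) e fun w => by
        refine le_trans (card_le_card fun y hy => ?_) (card_units_pow_eq_le he (w ()))
        simp only [mem_filter_univ] at hy ⊢
        exact congrFun hy ()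
    simp only [dotProduct, univ_unique, sum_singleton, Fintype.card_unit, pow_one] at this
    refine le_trans (le_of_eq ?_) this
    exact (Fintype.sum_equiv (Equiv.funUnique Unit F) _ _ fun u => rfl).symm
  have h2 : ∀ u : Fˣ, S (μ * (u : F) ^ e) = S μ := fun u => by
    simp only [S]
    congr 2
    refine Fintype.sum_equiv (Equiv.mulLeft u) _ _ fun y => ?_
    simp [mul_pow, mul_assoc]
  have h3 : ∑ u : Fˣ, S (μ * (u : F) ^ e) ≤ e * ∑ ν, S ν := by
    rw [← sum_fiberwise univ (fun u : Fˣ => μ * (u : F) ^ e), mul_sum]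
    refine sum_le_sum fun ν _ => ?_
    rw [sum_congr rfl (g := fun _ => S ν) (by simp +contextual), sum_const, nsmul_eq_mul]
    gcongr
    refine le_trans (card_le_card fun y hy => ?_) (card_units_pow_eq_le he (ν / μ))
    simp only [mem_filter_univ] at hy ⊢
    rw [← hy]
    field_simp
  rw [sum_congr rfl fun u _ => h2 u, sum_const, nsmul_eq_mul, card_univ] at h3
  have hpos : (0 : ℝ) < Fintype.card Fˣ := by exact_mod_cast Fintype.card_pos
  have h4 : S μ ≤ (e * √(Fintype.card F)) ^ 2 := by
    rw [mul_pow, Real.sq_sqrt (Nat.cast_nonneg _)]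
    refine le_of_mul_le_mul_left ?_ hpos
    have : (e : ℝ) * ∑ ν, S ν ≤ e * (Fintype.card F * (Fintype.card Fˣ * e)) := by gcongr
    linarith
  exact le_of_sq_le_sq h4 (by positivity)

open Finset in
/-- Vectors orthogonal to `K` columns, when any `card J` of the columns are independent. -/
theorem card_dotProduct_eq_zero_le {F J M : Type*} [Field F] [Fintype F] [DecidableEq F]
    [Fintype J] [DecidableEq J] [Fintype M] [DecidableEq M] (v : M → J → F)
    (hJM : Fintype.card J ≤ Fintype.card M)
    (hv : ∀ K : Finset M, #K = Fintype.card J → ∀ u : J → F, (∀ l ∈ K, u ⬝ᵥ v l = 0) → u = 0)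
    (K : Finset M) (hK : #K ≤ Fintype.card J) :
    #{u : J → F | ∀ l ∈ K, u ⬝ᵥ v l = 0} ≤ Fintype.card F ^ (Fintype.card J - #K) := by
  obtain ⟨K', hKK', hK'⟩ := exists_superset_card_eq hK hJM
  calc #{u : J → F | ∀ l ∈ K, u ⬝ᵥ v l = 0}
      ≤ #(univ : Finset (↥(K' \ K) → F)) := by
        refine card_le_card_of_injOn (fun u l => u ⬝ᵥ v l) (by simp) ?_
        intro u hu w hw huw
        simp only [coe_filter, mem_univ, true_and, Set.mem_ofPred_eq] at hu hw
        refine sub_eq_zero.1 (hv K' hK' _ fun l hl => ?_)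
        rw [sub_dotProduct, sub_eq_zero]
        by_cases h : l ∈ K
        · rw [hu l h, hw l h]
        · exact congrFun huw ⟨l, mem_sdiff.2 ⟨hl, h⟩⟩
    _ = _ := by rw [card_univ, Fintype.card_fun, Fintype.card_coe, card_sdiff_of_subset hKK', hK']

open Finset in
theorem AddChar.card_pow_mul_card_solutions {F J M X : Type*} [Field F] [Fintype F]
    [DecidableEq F] [Fintype J] [DecidableEq J] [Fintype M] [DecidableEq M] [Fintype X]
    {ψ : AddChar F ℂ} (hψ : ψ.IsPrimitive) (G : X → J → F) (v : M → J → F) (e : M → ℕ) :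
    (Fintype.card F : ℂ) ^ Fintype.card J
        * #{p : X × (M → Fˣ) | G p.1 + ∑ l, (p.2 l : F) ^ e l • v l = 0}
      = ∑ u : J → F, (∑ x, ψ (u ⬝ᵥ G x)) * ∏ l, ∑ y : Fˣ, ψ (u ⬝ᵥ v l * (y : F) ^ e l) := by
  have h : ∀ (u : J → F) (y : M → Fˣ), ψ (u ⬝ᵥ ∑ l, (y l : F) ^ e l • v l)
      = ∏ l, ψ (u ⬝ᵥ v l * (y l : F) ^ e l) := fun u y => by
    rw [dotProduct_sum]
    induction (univ : Finset M) using Finset.induction_on with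
    | empty => simp
    | insert j s hj ih =>
      rw [sum_insert hj, prod_insert hj, AddChar.map_add_eq_mul, ih, dotProduct_smul,
        smul_eq_mul, mul_comm (u ⬝ᵥ v j)]
  simp_rw [prod_univ_sum, Fintype.piFinset_univ, ← h, sum_mul_sum, ← AddChar.map_add_eq_mul,
    ← dotProduct_add]
  simp_rw [← Fintype.sum_prod_type'
    (f := fun x (y : M → Fˣ) => ψ (_ ⬝ᵥ (G x + ∑ l, (y l : F) ^ e l • v l)))]
  rw [sum_comm]
  simp_rw [AddChar.sum_apply_dotProduct hψ]
  rw [← sum_filter, sum_const, nsmul_eq_mul, mul_comm]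

open Finset in
/-- Contribution of the frequencies whose set of orthogonal columns is exactly `K`. -/
theorem AddChar.sum_norm_mul_prod_le {F J M X : Type*} [Field F] [Fintype F]
    [DecidableEq F] [Fintype J] [DecidableEq J] [Fintype M] [DecidableEq M] [Fintype X]
    {ψ : AddChar F ℂ} (hψ : ψ.IsPrimitive) (G : X → J → F) (D : ℕ)
    (hG : ∀ w, #{x | G x = w} ≤ D) (hX : Fintype.card X ≤ Fintype.card F ^ Fintype.card J)
    (v : M → J → F) (e : M → ℕ) (d : ℕ) (he : ∀ l, 0 < e l) (hed : ∀ l, e l ≤ d)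
    (hJM : Fintype.card J ≤ Fintype.card M)
    (hv : ∀ K : Finset M, #K = Fintype.card J → ∀ u : J → F, (∀ l ∈ K, u ⬝ᵥ v l = 0) → u = 0)
    (K : Finset M) :
    ∑ u : J → F with u ≠ 0 ∧ ({l | u ⬝ᵥ v l = 0} : Finset M) = K,
        ‖(∑ x, ψ (u ⬝ᵥ G x)) * ∏ l, ∑ y : Fˣ, ψ (u ⬝ᵥ v l * (y : F) ^ e l)‖
      ≤ (Fintype.card F : ℝ) ^ Fintype.card J * (d ^ Fintype.card M * √D
        * √(Fintype.card F) ^ (Fintype.card M + Fintype.card J)) := by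
  by_cases hK : Fintype.card J ≤ #K
  · obtain ⟨K', hK', hcard⟩ := exists_subset_card_eq hK
    rw [filter_false_of_mem, sum_empty]
    · positivity
    · rintro u - ⟨hu, rfl⟩
      exact hu (hv K' hcard u fun l hl => by simpa using hK' hl)
  push Not at hK
  set q := Fintype.card F
  set n := Fintype.card J
  set m := Fintype.card M
  have hKm : #K ≤ m := card_le_univ K
  have hq1 : 1 ≤ q := Fintype.card_pos
  set r : ℝ := √q with hr
  have hrq : r ^ 2 = q := Real.sq_sqrt (Nat.cast_nonneg _)
  have hr0 : 0 ≤ r := Real.sqrt_nonneg _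
  set B : ℝ := d ^ m * r ^ (m + #K)
  have hprod : ∀ u : J → F, ({l | u ⬝ᵥ v l = 0} : Finset M) = K →
      ‖∏ l, ∑ y : Fˣ, ψ (u ⬝ᵥ v l * (y : F) ^ e l)‖ ≤ B := by
    intro u hu
    have hbound : ∀ l, ‖∑ y : Fˣ, ψ (u ⬝ᵥ v l * (y : F) ^ e l)‖
        ≤ d * (r * if l ∈ K then r else 1) := by
      intro l
      have hd : (1 : ℝ) ≤ d := by exact_mod_cast (he l).trans_le (hed l)
      split_ifs with h
      · refine (norm_sum_le _ _).trans ?_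
        simp only [AddChar.norm_apply, sum_const, card_univ, nsmul_eq_mul, mul_one]
        have : (Fintype.card Fˣ : ℝ) ≤ r * r := by
          rw [← sq, hrq]
          exact_mod_cast Fintype.card_le_of_injective _ (Units.val_injective (α := F))
        nlinarith
      · rw [mul_one]
        refine (AddChar.norm_sum_units_pow_le hψ (he l) fun h0 => h ?_).trans ?_
        · rw [← hu]
          simpa using h0
        · have : (e l : ℝ) ≤ d := by exact_mod_cast hed l
          gcongr
    rw [norm_prod]
    refine (prod_le_prod (fun _ _ => norm_nonneg _) fun l _ => hbound l).trans (le_of_eq ?_)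
    rw [prod_mul_distrib, prod_mul_distrib, prod_ite]
    simp [B, m, pow_add]
  set V : Finset (J → F) := {u | ∀ l ∈ K, u ⬝ᵥ v l = 0}
  have hV : (#V : ℝ) ≤ r ^ (2 * (n - #K)) := by
    rw [pow_mul, hrq]
    exact_mod_cast card_dotProduct_eq_zero_le v hJM hv K hK.le
  have hT : ∑ u ∈ V, ‖∑ x, ψ (u ⬝ᵥ G x)‖ ≤ √D * r ^ (n - #K + 2 * n) := by
    refine le_of_sq_le_sq ?_ (by positivity)
    refine sq_sum_le_card_mul_sum_sq.trans ?_
    have h1 : ∑ u ∈ V, ‖∑ x, ψ (u ⬝ᵥ G x)‖ ^ 2 ≤ (q : ℝ) ^ n * (q ^ n * D) := by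
      refine (sum_le_univ_sum_of_nonneg fun _ => by positivity).trans ?_
      refine (AddChar.sum_norm_sq_sum_dotProduct_le hψ G D hG).trans ?_
      have : (Fintype.card X : ℝ) ≤ q ^ n := by exact_mod_cast hX
      gcongr
    calc _ ≤ r ^ (2 * (n - #K)) * ((q : ℝ) ^ n * (q ^ n * D)) := by gcongr
      _ = _ := by
        rw [mul_pow, Real.sq_sqrt (Nat.cast_nonneg _), ← hrq]
        ring
  calc _ ≤ ∑ u : J → F with u ≠ 0 ∧ ({l | u ⬝ᵥ v l = 0} : Finset M) = K,
        ‖∑ x, ψ (u ⬝ᵥ G x)‖ * B := by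
        refine sum_le_sum fun u hu => ?_
        rw [norm_mul]
        gcongr
        exact hprod u (mem_filter.1 hu).2.2
    _ ≤ ∑ u ∈ V, ‖∑ x, ψ (u ⬝ᵥ G x)‖ * B := by
        refine sum_le_sum_of_subset_of_nonneg (fun u hu => ?_) fun _ _ _ => by positivity
        simp only [mem_filter_univ, V] at hu ⊢
        intro l hl
        rw [← hu.2] at hl
        simpa using hl
    _ ≤ √D * r ^ (n - #K + 2 * n) * B := by
        rw [← sum_mul]
        gcongr
    _ = _ := by
        obtain ⟨k, hk⟩ := Nat.exists_eq_add_of_le hK.le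
        rw [← hrq, hk]
        simp only [B, Nat.add_sub_cancel_left]
        ring

open Finset in
/-- Number of solutions of a system `G x + ∑ y_l ^ e_l • v_l = 0` with all `y_l` nonzero. -/
theorem abs_card_solutions_sub_le {F J M X : Type*} [Field F] [Fintype F]
    [DecidableEq F] [Fintype J] [DecidableEq J] [Fintype M] [DecidableEq M] [Fintype X]
    (G : X → J → F) (D : ℕ)
    (hG : ∀ w, #{x | G x = w} ≤ D) (hX : Fintype.card X ≤ Fintype.card F ^ Fintype.card J)
    (v : M → J → F) (e : M → ℕ) (d : ℕ) (he : ∀ l, 0 < e l) (hed : ∀ l, e l ≤ d)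
    (hJM : Fintype.card J ≤ Fintype.card M)
    (hv : ∀ K : Finset M, #K = Fintype.card J → ∀ u : J → F, (∀ l ∈ K, u ⬝ᵥ v l = 0) → u = 0) :
    |(#{p : X × (M → Fˣ) | G p.1 + ∑ l, (p.2 l : F) ^ e l • v l = 0} : ℝ)
        - Fintype.card X * (Fintype.card F - 1 : ℝ) ^ Fintype.card M
          / Fintype.card F ^ Fintype.card J|
      ≤ 2 ^ Fintype.card M * (d ^ Fintype.card M * √D
        * √(Fintype.card F) ^ (Fintype.card M + Fintype.card J)) := by
  obtain ⟨ψ, hψ1⟩ := AddChar.exists_apply_ne_zero.2 (one_ne_zero (α := F))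
  have hψ : ψ.IsPrimitive := AddChar.IsPrimitive.of_ne_one fun h => hψ1 (by simp [h])
  have hq0 : (0 : ℝ) < (Fintype.card F : ℝ) ^ Fintype.card J :=
    pow_pos (by exact_mod_cast Fintype.card_pos) _
  set N := #{p : X × (M → Fˣ) | G p.1 + ∑ l, (p.2 l : F) ^ e l • v l = 0}
  let f : (J → F) → ℂ := fun u =>
    (∑ x, ψ (u ⬝ᵥ G x)) * ∏ l, ∑ y : Fˣ, ψ (u ⬝ᵥ v l * (y : F) ^ e l)
  have hunits : (Fintype.card Fˣ : ℂ) = Fintype.card F - 1 := by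
    rw [Fintype.card_units, Nat.cast_sub Fintype.card_pos, Nat.cast_one]
  have hf0 : f 0 = Fintype.card X * (Fintype.card F - 1 : ℂ) ^ Fintype.card M := by
    simp [f, hunits]
  have hsum : (Fintype.card F : ℂ) ^ Fintype.card J * N
      - Fintype.card X * (Fintype.card F - 1 : ℂ) ^ Fintype.card M = ∑ u with u ≠ 0, f u := by
    rw [AddChar.card_pow_mul_card_solutions hψ G v e, ← hf0, filter_ne', sub_eq_iff_eq_add,
      sum_erase_add _ _ (mem_univ _)]
  rw [← mul_le_mul_iff_right₀ hq0]
  calc _ = ‖∑ u with u ≠ 0, f u‖ := by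
        rw [← hsum, ← abs_of_pos hq0, ← abs_mul, ← Real.norm_eq_abs, ← Complex.norm_real,
          abs_of_pos hq0]
        congr 1
        rw [mul_sub, mul_div_cancel₀ _ hq0.ne']
        push_cast
        rfl
    _ ≤ ∑ u with u ≠ 0, ‖f u‖ := norm_sum_le _ _
    _ = ∑ K : Finset M, ∑ u with u ≠ 0 ∧ ({l | u ⬝ᵥ v l = 0} : Finset M) = K, ‖f u‖ := by
        rw [← sum_fiberwise _ (fun u : J → F => ({l | u ⬝ᵥ v l = 0} : Finset M))]
        simp_rw [filter_filter]
    _ ≤ ∑ _K : Finset M, (Fintype.card F : ℝ) ^ Fintype.card J * (d ^ Fintype.card M * √D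
        * √(Fintype.card F) ^ (Fintype.card M + Fintype.card J)) :=
        sum_le_sum fun K _ => AddChar.sum_norm_mul_prod_le hψ G D hG hX v e d he hed hJM hv K
    _ = _ := by
        rw [sum_const, card_univ, Fintype.card_finset, nsmul_eq_mul]
        push_cast
        ring

open Finset in
/-- Fibres of a square Markoff–Hurwitz-type map with leading diagonal powers. -/
theorem card_fiber_markoff_hurwitz_le {F σ : Type*} [Field F] [Fintype F] [DecidableEq F]
    [Fintype σ] [DecidableEq σ] (P : Matrix σ σ F) (hP : P.det ≠ 0) (e : σ → ℕ)
    (he : ∀ l, 0 < e l) (c : σ → σ → ℕ) (hc : ∀ j l, ∑ i, c j i < e l) (a b w : σ → F) :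
    #{x : σ → Fˣ | (fun j => ∑ l, P j l * (x l : F) ^ e l + a j - b j * ∏ l, (x l : F) ^ c j l)
      = w} ≤ ∏ l, e l := by
  classical
  let h : σ → MvPolynomial σ F := fun j =>
    MvPolynomial.C (w j - a j) + MvPolynomial.C (b j) * ∏ i, MvPolynomial.X i ^ c j i
  let g : σ → MvPolynomial σ F := fun l => ∑ j, MvPolynomial.C (P⁻¹ l j) * h j
  have hinj : Function.Injective fun (x : σ → Fˣ) (l : σ) => (x l : F) := fun x y hxy =>
    funext fun l => Units.ext (congrFun hxy l)
  rw [← card_image_of_injective _ hinj]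
  refine card_solutions_le_prod_of_totalDegree_lt e g (fun l => ?_) _ fun x hx l => ?_
  · refine MvPolynomial.totalDegree_finsetSum_le (d := e l - 1) (fun j _ => ?_) |>.trans_lt
      (Nat.sub_lt (he l) one_pos)
    refine (MvPolynomial.totalDegree_mul _ _).trans ?_
    rw [MvPolynomial.totalDegree_C, zero_add]
    refine (MvPolynomial.totalDegree_add _ _).trans ?_
    rw [MvPolynomial.totalDegree_C, zero_max]
    refine (MvPolynomial.totalDegree_mul _ _).trans ?_
    rw [MvPolynomial.totalDegree_C, zero_add]
    refine (MvPolynomial.totalDegree_finsetProd _ _).trans ?_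
    have : ∑ i, (MvPolynomial.X i ^ c j i : MvPolynomial σ F).totalDegree ≤ ∑ i, c j i :=
      sum_le_sum fun i _ => by simp
    have := hc j l
    omega
  · obtain ⟨x, hmem, rfl⟩ := mem_image.1 hx
    have hfib := (mem_filter.1 hmem).2
    have hsys : P.mulVec (fun l => (x l : F) ^ e l)
        = fun j => MvPolynomial.eval (fun l => (x l : F)) (h j) := by
      ext j
      have := congrFun hfib j
      simp only [Matrix.mulVec, dotProduct, h, map_add, map_mul, MvPolynomial.eval_C, map_prod,
        map_pow, MvPolynomial.eval_X]
      linear_combination this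
    have hinv : P⁻¹.mulVec (P.mulVec fun l => (x l : F) ^ e l) = fun l => (x l : F) ^ e l := by
      rw [Matrix.mulVec_mulVec, Matrix.nonsing_inv_mul _ (isUnit_iff_ne_zero.2 hP),
        Matrix.one_mulVec]
    have := congrFun hinv l
    rw [hsys] at this
    simp only [← this, g, map_sum, map_mul, MvPolynomial.eval_C, Matrix.mulVec, dotProduct]

open Finset in
theorem abs_sub_one_pow_div_sub_sum_le {q : ℝ} (hq : 1 ≤ q) {t n : ℕ} (h : 2 * n ≤ t) :
    |(q - 1) ^ t / q ^ n
        - ∑ i ∈ range (t - 2 * n), (-1 : ℝ) ^ i * t.choose i * q ^ (t - n - i)|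
      ≤ 2 ^ t * q ^ n := by
  have hq0 : 0 < q := by linarith
  have hqn : 0 < q ^ n := pow_pos hq0 n
  have hexp : (q - 1) ^ t = ∑ i ∈ range (t + 1), (-1 : ℝ) ^ i * t.choose i * q ^ (t - i) := by
    rw [sub_eq_neg_add, add_pow]
    exact sum_congr rfl fun i _ => by ring
  have hhead : q ^ n * ∑ i ∈ range (t - 2 * n), (-1 : ℝ) ^ i * t.choose i * q ^ (t - n - i)
      = ∑ i ∈ range (t - 2 * n), (-1 : ℝ) ^ i * t.choose i * q ^ (t - i) := by
    rw [mul_sum]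
    refine sum_congr rfl fun i hi => ?_
    rw [mem_range] at hi
    rw [show t - i = n + (t - n - i) by omega, pow_add]
    ring
  rw [← mul_le_mul_iff_right₀ hqn]
  calc _ = |∑ i ∈ range (t + 1) \ range (t - 2 * n),
          (-1 : ℝ) ^ i * t.choose i * q ^ (t - i)| := by
        rw [sum_sdiff_eq_sub (range_subset_range.2 (by omega)), ← hexp, ← hhead]
        nth_rewrite 1 [← abs_of_pos hqn]
        rw [← abs_mul, mul_sub, mul_div_cancel₀ _ hqn.ne']
    _ ≤ ∑ i ∈ range (t + 1) \ range (t - 2 * n), t.choose i * q ^ (2 * n) := by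
        refine (abs_sum_le_sum_abs _ _).trans (sum_le_sum fun i hi => ?_)
        simp only [mem_sdiff, mem_range] at hi
        rw [abs_mul, abs_mul, abs_pow, abs_neg, abs_one, one_pow, one_mul, Nat.abs_cast,
          abs_of_pos (pow_pos hq0 _)]
        gcongr
        omega
    _ ≤ ∑ i ∈ range (t + 1), t.choose i * q ^ (2 * n) :=
        sum_le_sum_of_subset_of_nonneg sdiff_subset fun _ _ _ => by positivity
    _ = _ := by
        rw [← sum_mul, ← Nat.cast_sum, Nat.sum_range_choose]
        push_cast
        ring

/-- estimate for the number N* of solutions with all coordinates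
nonzero of a system of generalized Markoff–Hurwitz-type equations. -/
theorem markoff_hurwitz_system_nonzero_solutions_estimate
    (q t n : ℕ) (hq : IsPrimePow q) (hq2 : 2 < q)
    (F : Type*) [Field F] [Fintype F] (hFq : Fintype.card F = q)
    (ht : 0 < t) (hn : 0 < n) (hnt : 2 * n + 2 ≤ t) (hnt' : n ≤ t)
    (d : Fin t → ℕ) (hd : StrictAnti d) (hd2 : ∀ i, 2 ≤ d i)
    (hchar : ∀ i, ¬ (ringChar F ∣ d i))
    (A : Matrix (Fin n) (Fin t) F)
    (hH : ∀ φ : Fin n ↪ Fin t, (A.submatrix id φ).det ≠ 0)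
    (c : Fin n → Fin n → ℕ) (hc : ∀ j l, 0 < c j l)
    (hcd : ∀ j, ∑ l, c j l < d ⟨t - 1, Nat.sub_lt ht Nat.one_pos⟩)
    (a : Fin n → F) (ha : ∃ j, a j ≠ 0)
    (b : Fin n → F) (hb : ∀ j, b j ≠ 0)
    (Nstar : ℕ)
    (hNstar : Nstar = Set.ncard {x : Fin t → F |
      (∀ j, x j ≠ 0) ∧
      ∀ j, ∑ l, A j l * x l ^ d l + a j
        = b j * ∏ l : Fin n, x (Fin.castLE hnt' l) ^ c j l}) :
    |(Nstar : ℝ)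
        - ∑ i ∈ Finset.range (t - 2 * n),
            (-1 : ℝ) ^ i * (t.choose i) * (q : ℝ) ^ (t - n - i)|
      ≤ ((15 * n * d ⟨0, ht⟩ : ℕ) : ℝ) ^ (t + 1) * (q : ℝ) ^ ((t : ℝ) / 2) := by
  classical
  obtain ⟨m, rfl⟩ := Nat.exists_eq_add_of_le hnt'
  subst hFq
  set d₀ := d ⟨0, ht⟩
  have hdle : ∀ i, d i ≤ d₀ := fun i => hd.antitone (Nat.zero_le i)
  have hdge : ∀ i, d ⟨n + m - 1, Nat.sub_lt ht Nat.one_pos⟩ ≤ d i := fun i =>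
    hd.antitone (Fin.mk_le_mk.2 (by omega) : i ≤ ⟨n + m - 1, Nat.sub_lt ht Nat.one_pos⟩)
  let G : (Fin n → Fˣ) → Fin n → F := fun x j =>
    ∑ l, A j (Fin.castAdd m l) * (x l : F) ^ d (Fin.castAdd m l) + a j
      - b j * ∏ l, (x l : F) ^ c j l
  let v : Fin m → Fin n → F := fun l j => A j (Fin.natAdd n l)
  have hG : ∀ w, Finset.card {x | G x = w} ≤ d₀ ^ n := fun w => by
    refine (card_fiber_markoff_hurwitz_le (A.submatrix id (Fin.castAddEmb m))
      (hH (Fin.castAddEmb m)) (fun l => d (Fin.castAdd m l))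
      (fun l => by have := hd2 (Fin.castAdd m l); omega) c
      (fun j l => (hcd j).trans_le (hdge _)) a b w).trans ?_
    refine (Finset.prod_le_prod' fun l _ => hdle _).trans ?_
    simp
  have hX : Fintype.card (Fin n → Fˣ) ≤ Fintype.card F ^ Fintype.card (Fin n) := by
    rw [Fintype.card_fun]
    exact Nat.pow_le_pow_left (Fintype.card_le_of_injective _ Units.val_injective) _
  have hv : ∀ K : Finset (Fin m), K.card = Fintype.card (Fin n) →
      ∀ u : Fin n → F, (∀ l ∈ K, u ⬝ᵥ v l = 0) → u = 0 := by
    intro K hK u hu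
    rw [Fintype.card_fin] at hK
    let φ : Fin n ↪ Fin (n + m) := (K.orderEmbOfFin hK).toEmbedding.trans (Fin.natAddEmb n)
    refine Matrix.eq_zero_of_vecMul_eq_zero (hH φ) ?_
    ext i
    exact hu _ (K.orderEmbOfFin_mem hK i)
  have hcount : Nstar = Finset.card {p : (Fin n → Fˣ) × (Fin m → Fˣ) |
      G p.1 + ∑ l, (p.2 l : F) ^ d (Fin.natAdd n l) • v l = 0} := by
    rw [hNstar, ← Set.ncard_coe_finset]
    symm
    refine Set.ncard_congr (fun p _ => Fin.append (fun l => (p.1 l : F)) (fun l => (p.2 l : F)))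
      ?_ ?_ ?_
    · rintro ⟨x, y⟩ hp
      simp only [Finset.coe_filter, Finset.mem_univ, true_and, Set.mem_ofPred_eq] at hp ⊢
      refine ⟨fun j => ?_, fun j => ?_⟩
      · refine Fin.addCases (fun i => ?_) (fun i => ?_) j <;> simp
      · have := congrFun hp j
        simp only [G, v, Pi.add_apply, Finset.sum_apply, Pi.smul_apply, smul_eq_mul,
          Pi.zero_apply] at this
        have hcast : ∀ l : Fin n, Fin.castLE hnt' l = Fin.castAdd m l := fun _ => rfl
        simp only [Fin.sum_univ_add, Fin.append_left, Fin.append_right, hcast]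
        simp only [mul_comm _ (A j (Fin.natAdd n _))] at this
        linear_combination this
    · rintro ⟨x, y⟩ ⟨x', y'⟩ _ _ h
      ext l
      · simpa using congrFun h (Fin.castAdd m l)
      · simpa using congrFun h (Fin.natAdd n l)
    · rintro z ⟨hz, hsys⟩
      refine ⟨(fun l => Units.mk0 _ (hz (Fin.castAdd m l)),
        fun l => Units.mk0 _ (hz (Fin.natAdd n l))), ?_, ?_⟩
      · simp only [Finset.coe_filter, Finset.mem_univ, true_and, Set.mem_ofPred_eq]
        ext j
        have := hsys j
        have hcast : ∀ l : Fin n, Fin.castLE hnt' l = Fin.castAdd m l := fun _ => rfl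
        simp only [Fin.sum_univ_add, hcast] at this
        simp only [G, v, Pi.add_apply, Finset.sum_apply, Pi.smul_apply, smul_eq_mul,
          Pi.zero_apply, Units.val_mk0, mul_comm _ (A j (Fin.natAdd n _))]
        linear_combination this
      · ext j
        refine Fin.addCases (fun i => ?_) (fun i => ?_) j <;> simp
  have hmain := abs_card_solutions_sub_le G (d₀ ^ n) hG hX v (fun l => d (Fin.natAdd n l)) d₀
    (fun l => by have := hd2 (Fin.natAdd n l); omega) (fun l => hdle _) (by simp; omega) hv
  rw [← hcount] at hmain
  have hq1 : (1 : ℝ) ≤ Fintype.card F := by exact_mod_cast Fintype.card_pos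
  have htail := abs_sub_one_pow_div_sub_sum_le hq1 (t := n + m) (n := n) (by omega)
  have hcardX : (Fintype.card (Fin n → Fˣ) : ℝ) = (Fintype.card F - 1 : ℝ) ^ n := by
    rw [Fintype.card_fun, Fintype.card_units, Fintype.card_fin, Nat.cast_pow,
      Nat.cast_sub Fintype.card_pos, Nat.cast_one]
  simp only [hcardX, Fintype.card_fin, ← pow_add] at hmain
  set r : ℝ := √(Fintype.card F) with hr
  have hr1 : 1 ≤ r := Real.one_le_sqrt.2 hq1
  have hrt : (Fintype.card F : ℝ) ^ (((n + m : ℕ) : ℝ) / 2) = r ^ (n + m) := by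
    rw [hr, Real.sqrt_eq_rpow, ← Real.rpow_natCast, ← Real.rpow_mul (by positivity)]
    congr 1
    ring
  have hqn : (Fintype.card F : ℝ) ^ n ≤ r ^ (n + m) := by
    rw [← Real.sq_sqrt (Nat.cast_nonneg (Fintype.card F)), ← hr, ← pow_mul]
    exact pow_le_pow_right₀ hr1 (by omega)
  have hd1 : (2 : ℝ) ≤ d₀ := by exact_mod_cast hd2 _
  have hn1 : (1 : ℝ) ≤ n := by exact_mod_cast hn
  have hsqrt : √((d₀ ^ n : ℕ) : ℝ) ≤ d₀ ^ n := by
    refine Real.sqrt_le_iff.2 ⟨by positivity, ?_⟩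
    push_cast
    exact le_self_pow₀ (one_le_pow₀ (by linarith)) two_ne_zero
  have hconst : (2 : ℝ) ^ m * (d₀ ^ m * d₀ ^ n) + 2 ^ (n + m)
      ≤ ((15 * n * d₀ : ℕ) : ℝ) ^ (n + m + 1) := by
    have h1 : (2 : ℝ) ^ m * (d₀ ^ m * d₀ ^ n) ≤ (2 * d₀) ^ (n + m) := by
      rw [mul_pow, ← pow_add, add_comm m n]
      gcongr
      · norm_num
      · omega
    have h2 : (2 : ℝ) ^ (n + m) ≤ (2 * d₀) ^ (n + m) := by
      gcongr
      linarith
    have h3 : (2 * d₀ : ℝ) ≤ 15 * n * d₀ := by nlinarith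
    calc _ ≤ (2 * d₀ : ℝ) ^ (n + m) * 2 := by linarith
      _ ≤ (2 * d₀ : ℝ) ^ (n + m) * (2 * d₀) := by gcongr; linarith
      _ = (2 * d₀ : ℝ) ^ (n + m + 1) := (pow_succ _ _).symm
      _ ≤ _ := by
        push_cast
        gcongr
  rw [hrt]
  refine (abs_sub_le _ _ _).trans ((add_le_add hmain htail).trans ?_)
  calc _ ≤ 2 ^ m * (d₀ ^ m * d₀ ^ n * r ^ (n + m)) + 2 ^ (n + m) * r ^ (n + m) := by
        rw [add_comm m n]
        gcongr
    _ = (2 ^ m * (d₀ ^ m * d₀ ^ n) + 2 ^ (n + m)) * r ^ (n + m) := by ring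
    _ ≤ _ := by gcongr
end

section
/- Let q be a prime power and 𝔽_q the finite field with q elements. Let t, n, d_1, …, d_t be positive integers with n < (t−1)/2, d_1 > d_2 > ⋯ > d_t ≥ 2, and suppose char(𝔽_q) does not divide d_i for 1 ≤ i ≤ t. Let A = (a_{ij}) ∈ 𝔽_q^{n×t} satisfy hypothesis (H). Let c_{jl} (1 ≤ j, l ≤ n) be positive integers with c_{j1} + ⋯ + c_{jn} < d_t for every j, let a_1, …, a_n ∈ 𝔽_q with a_j ≠ 0 for at least one j, and let b_1, …, b_n ∈ 𝔽_q all be nonzero. If q > (30 n d_1)^{(2t+2)/(t−2n)} (a real power), then there exists a tuple x = (x_1, …, x_t) ∈ (𝔽_q^*)^t with all coordinates nonzero such that ∑_{l=1}^t a_{jl} x_l^{d_l} + a_j = b_j · x_1^{c_{j1}} ⋯ x_n^{c_{jn}} for every 1 ≤ j ≤ n. -/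
open Finset

/-- An additive character turns finite sums into products. -/
theorem AddChar.map_finset_sum {A M α : Type*} [AddCommMonoid A] [CommMonoid M]
    (ψ : AddChar A M) (s : Finset α) (f : α → A) : ψ (∑ i ∈ s, f i) = ∏ i ∈ s, ψ (f i) := by
  classical
  induction s using Finset.induction_on with
  | empty => simp
  | insert a s ha ih => rw [sum_insert ha, prod_insert ha, ψ.map_add_eq_mul, ih]

section CharacterSums

variable {F : Type*} [Field F] [Fintype F] {ψ : AddChar F ℂ}

theorem AddChar.IsPrimitive.sum_dotProduct {ι : Type*} [Fintype ι] [DecidableEq ι] [DecidableEq F]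
    (hψ : ψ.IsPrimitive) (v : ι → F) :
    ∑ u : ι → F, ψ (u ⬝ᵥ v) = if v = 0 then (Fintype.card F : ℂ) ^ Fintype.card ι else 0 := by
  split_ifs with hv
  · simp [hv]
  obtain ⟨j, hj⟩ := Function.ne_iff.mp hv
  simp_rw [dotProduct, ψ.map_finset_sum]
  rw [← Fintype.prod_sum fun i r ↦ ψ (r * v i)]
  refine prod_eq_zero (mem_univ j) ?_
  simpa [AddChar.sum_mulShift _ hψ] using hj

theorem sum_norm_sq_sum_char_le {ι α : Type*} [Fintype ι] [DecidableEq ι] [DecidableEq F]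
    [Fintype α] (hψ : ψ.IsPrimitive) (f : α → ι → F) (D : ℕ)
    (hf : ∀ v, #{x | f x = v} ≤ D) :
    ∑ u : ι → F, ‖∑ x, ψ (u ⬝ᵥ f x)‖ ^ 2
      ≤ (Fintype.card F : ℝ) ^ Fintype.card ι * D * Fintype.card α := by
  have h (u : ι → F) : ((‖∑ x, ψ (u ⬝ᵥ f x)‖ ^ 2 : ℝ) : ℂ)
      = ∑ x, ∑ y, ψ (u ⬝ᵥ (f x - f y)) := by
    push_cast
    rw [← Complex.mul_conj', map_sum, sum_mul_sum]
    refine sum_congr rfl fun x _ ↦ sum_congr rfl fun y _ ↦ ?_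
    rw [← AddChar.map_neg_eq_conj, ← AddChar.map_add_eq_mul, dotProduct_sub, sub_eq_add_neg]
  have key : ∑ u : ι → F, ‖∑ x, ψ (u ⬝ᵥ f x)‖ ^ 2
      = (Fintype.card F : ℝ) ^ Fintype.card ι * ∑ x, (#{y | f y = f x} : ℝ) := by
    rw [← Complex.ofReal_inj, Complex.ofReal_sum]
    simp_rw [h]
    rw [sum_comm]
    push_cast
    rw [mul_sum]
    refine sum_congr rfl fun x _ ↦ ?_
    rw [sum_comm]
    simp_rw [hψ.sum_dotProduct, sub_eq_zero, eq_comm (a := f x)]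
    rw [← sum_filter, sum_const, nsmul_eq_mul, mul_comm]
  rw [key, mul_assoc]
  gcongr
  calc ∑ x, (#{y | f y = f x} : ℝ) ≤ ∑ _x : α, (D : ℝ) := by
        gcongr with x; exact_mod_cast hf _
    _ = _ := by simp [mul_comm]

theorem card_units_pow_eq_le_s14 [DecidableEq F] {d : ℕ} (hd : 0 < d) (v : F) :
    #{x : Fˣ | (x : F) ^ d = v} ≤ d := by
  classical
  calc #{x : Fˣ | (x : F) ^ d = v}
      ≤ #(Polynomial.nthRoots d v).toFinset := by
        refine card_le_card_of_injOn (fun x ↦ (x : F)) (fun x hx ↦ ?_) Units.val_injective.injOn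
        simpa [Polynomial.mem_nthRoots hd] using hx
    _ ≤ _ := (Multiset.toFinset_card_le _).trans (Polynomial.card_nthRoots d v)

theorem norm_sq_sum_units_char_pow_le [DecidableEq F] (hψ : ψ.IsPrimitive) {d : ℕ} (hd : 0 < d)
    {r : F} (hr : r ≠ 0) :
    ‖∑ x : Fˣ, ψ (r * (x : F) ^ d)‖ ^ 2 ≤ (d : ℝ) ^ 2 * Fintype.card F := by
  set S : F → ℝ := fun s ↦ ‖∑ x : Fˣ, ψ (s * (x : F) ^ d)‖ ^ 2 with hS
  have hpos : (0 : ℝ) < Fintype.card Fˣ := by exact_mod_cast Fintype.card_pos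
  have hinv (y : Fˣ) : S (r * (y : F) ^ d) = S r := by
    simp only [hS]
    congr 2
    refine Fintype.sum_equiv (Equiv.mulLeft y) _ _ fun x ↦ ?_
    simp [mul_pow, mul_assoc]
  have hmoment : ∑ s, S s ≤ (Fintype.card F : ℝ) * d * Fintype.card Fˣ := by
    have := sum_norm_sq_sum_char_le (ι := Unit) hψ (fun (x : Fˣ) _ ↦ (x : F) ^ d) d fun v ↦ by
      refine le_trans (card_le_card fun x hx ↦ ?_) (card_units_pow_eq_le_s14 hd (v ()))
      simpa using congrFun (mem_filter.mp hx).2 ()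
    rw [← Fintype.sum_equiv (Equiv.funUnique Unit F).symm S _ fun s ↦ by
      simp [hS, dotProduct]] at this
    simpa using this
  have horbit : (Fintype.card Fˣ : ℝ) * S r ≤ d * ∑ s, S s := by
    calc (Fintype.card Fˣ : ℝ) * S r = ∑ y : Fˣ, S (r * (y : F) ^ d) := by simp [hinv]
      _ = ∑ s, ∑ y ∈ {y : Fˣ | r * (y : F) ^ d = s}, S (r * (y : F) ^ d) :=
        
        (sum_fiberwise univ (fun y : Fˣ ↦ r * (y : F) ^ d) _).symm
      _ = ∑ s, (#{y : Fˣ | r * (y : F) ^ d = s} : ℝ) * S s := by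
        refine sum_congr rfl fun s _ ↦ ?_
        rw [sum_congr rfl (g := fun _ ↦ S s) fun y hy ↦ by rw [(mem_filter.mp hy).2]]
        simp
      _ ≤ ∑ s, (d : ℝ) * S s := by
        gcongr with s
        refine le_trans (card_le_card fun y hy ↦ ?_) (card_units_pow_eq_le_s14 hd (s / r))
        simpa [eq_div_iff hr, mul_comm _ r] using hy
      _ = _ := by rw [mul_sum]
  refine le_of_mul_le_mul_left (horbit.trans ?_) hpos
  calc (d : ℝ) * ∑ s, S s ≤ d * ((Fintype.card F : ℝ) * d * Fintype.card Fˣ) := by gcongr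
    _ = _ := by ring

variable [DecidableEq F] {ι κ : Type*} [Fintype ι] [DecidableEq ι] [Fintype κ]

theorem sum_norm_sq_prod_char_pow_le (hψ : ψ.IsPrimitive) (B : κ → ι → F)
    (hB : ∀ L : Finset κ, #{u : ι → F | u ≠ 0 ∧ ∀ l ∈ L, u ⬝ᵥ B l = 0} * Fintype.card F ^ #L
      ≤ Fintype.card F ^ Fintype.card ι)
    (e : κ → ℕ) (d : ℕ) (he0 : ∀ l, 0 < e l) (he : ∀ l, e l ≤ d) :
    ∑ u : ι → F with u ≠ 0, ‖∏ l, ∑ y : Fˣ, ψ ((u ⬝ᵥ B l) * (y : F) ^ e l)‖ ^ 2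
      ≤ (2 * (d : ℝ) ^ 2 * Fintype.card F) ^ Fintype.card κ
        * (Fintype.card F : ℝ) ^ Fintype.card ι := by
  classical
  set q : ℝ := (Fintype.card F : ℝ) with hq
  have hq0 : 0 ≤ q := by positivity
  have hS (u : ι → F) (l : κ) : ‖∑ y : Fˣ, ψ ((u ⬝ᵥ B l) * (y : F) ^ e l)‖ ^ 2
      ≤ (d : ℝ) ^ 2 * q * (1 + if u ⬝ᵥ B l = 0 then q else 0) := by
    have hde : (e l : ℝ) ≤ d := by exact_mod_cast he l
    split_ifs with h
    · have h1 : (1 : ℝ) ≤ d := by exact_mod_cast (he0 l).trans_le (he l)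
      have hcard : (Fintype.card Fˣ : ℝ) ≤ q := by
        rw [hq]
        exact_mod_cast Fintype.card_le_of_injective _ (Units.val_injective (α := F))
      calc ‖∑ y : Fˣ, ψ ((u ⬝ᵥ B l) * (y : F) ^ e l)‖ ^ 2 = (Fintype.card Fˣ : ℝ) ^ 2 := by
            simp [h]
        _ ≤ q ^ 2 := by gcongr
        _ ≤ 1 ^ 2 * q * (1 + q) := by nlinarith
        _ ≤ _ := by gcongr
    · refine (norm_sq_sum_units_char_pow_le hψ (he0 l) h).trans ?_
      rw [add_zero, mul_one]
      gcongr
  have hL (L : Finset κ) : ∑ u : ι → F with u ≠ 0, ∏ l ∈ L, (if u ⬝ᵥ B l = 0 then q else 0)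
      ≤ q ^ Fintype.card ι := by
    simp_rw [prod_ite_zero, prod_const]
    rw [← sum_filter, sum_const, filter_filter, nsmul_eq_mul]
    rw [hq]
    exact_mod_cast hB L
  calc ∑ u : ι → F with u ≠ 0, ‖∏ l, ∑ y : Fˣ, ψ ((u ⬝ᵥ B l) * (y : F) ^ e l)‖ ^ 2
      ≤ ∑ u : ι → F with u ≠ 0,
          ∏ l, ((d : ℝ) ^ 2 * q * (1 + if u ⬝ᵥ B l = 0 then q else 0)) := by
        simp_rw [norm_prod, ← prod_pow]
        gcongr with u _ l
        exact hS u l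
    _ = ((d : ℝ) ^ 2 * q) ^ Fintype.card κ * ∑ L : Finset κ,
          ∑ u : ι → F with u ≠ 0, ∏ l ∈ L, (if u ⬝ᵥ B l = 0 then q else 0) := by
        rw [sum_comm, mul_sum]
        refine sum_congr rfl fun u _ ↦ ?_
        rw [prod_mul_distrib, prod_const, prod_one_add, card_univ, powerset_univ]
    _ ≤ ((d : ℝ) ^ 2 * q) ^ Fintype.card κ * ∑ _L : Finset κ, q ^ Fintype.card ι := by
        gcongr with L
        exact hL L
    _ = _ := by
        rw [sum_const, card_univ, Fintype.card_finset, nsmul_eq_mul, mul_assoc 2, mul_pow 2]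
        push_cast
        ring

theorem exists_add_sum_units_pow_smul_eq_zero {α : Type*} [Fintype α] (f : α → ι → F) (D : ℕ)
    (hf : ∀ v, #{x | f x = v} ≤ D) (B : κ → ι → F)
    (hB : ∀ L : Finset κ, #{u : ι → F | u ≠ 0 ∧ ∀ l ∈ L, u ⬝ᵥ B l = 0} * Fintype.card F ^ #L
      ≤ Fintype.card F ^ Fintype.card ι)
    (e : κ → ℕ) (d : ℕ) (he0 : ∀ l, 0 < e l) (he : ∀ l, e l ≤ d)
    (hlarge : (Fintype.card F : ℝ) ^ (2 * Fintype.card ι) * D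
        * (2 * (d : ℝ) ^ 2 * Fintype.card F) ^ Fintype.card κ
      < Fintype.card α * (Fintype.card Fˣ : ℝ) ^ (2 * Fintype.card κ)) :
    ∃ (x : α) (y : κ → Fˣ), f x + ∑ l, (y l : F) ^ e l • B l = 0 := by
  classical
  by_contra! hne
  have hψ := AddChar.FiniteField.primitiveChar_to_Complex_isPrimitive F
  set ψ := AddChar.FiniteField.primitiveChar_to_Complex F
  set T : (ι → F) → ℂ := fun u ↦ ∑ x, ψ (u ⬝ᵥ f x) with hT
  set S : (ι → F) → ℂ := fun u ↦ ∏ l, ∑ y : Fˣ, ψ ((u ⬝ᵥ B l) * (y : F) ^ e l) with hS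
  have hzero : ∑ u, T u * S u = 0 := by
    have (u : ι → F) : T u * S u
        = ∑ x, ∑ y : κ → Fˣ, ψ (u ⬝ᵥ (f x + ∑ l, (y l : F) ^ e l • B l)) := by
      simp only [hT, hS]
      rw [Fintype.prod_sum, sum_mul_sum]
      refine sum_congr rfl fun x _ ↦ sum_congr rfl fun y _ ↦ ?_
      rw [dotProduct_add, ψ.map_add_eq_mul, dotProduct_sum, ψ.map_finset_sum]
      simp [mul_comm]
    simp_rw [this]
    rw [sum_comm]
    refine sum_eq_zero fun x _ ↦ ?_
    rw [sum_comm]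
    refine sum_eq_zero fun y _ ↦ ?_
    rw [hψ.sum_dotProduct, if_neg (hne x y)]
  have hmain : T 0 * S 0 = Fintype.card α * (Fintype.card Fˣ : ℂ) ^ Fintype.card κ := by
    simp [hT, hS]
  have hsplit : (Fintype.card α : ℝ) * (Fintype.card Fˣ : ℝ) ^ Fintype.card κ
      = ‖∑ u with u ≠ 0, T u * S u‖ := by
    have h0 : T 0 * S 0 + ∑ u with u ≠ 0, T u * S u = 0 := by
      rw [← hzero, filter_ne', add_sum_erase univ (fun u ↦ T u * S u) (mem_univ 0)]
    rw [eq_neg_of_add_eq_zero_right h0, norm_neg, hmain]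
    simp
  have hbound : ((Fintype.card α : ℝ) * (Fintype.card Fˣ : ℝ) ^ Fintype.card κ) ^ 2
      ≤ ((Fintype.card F : ℝ) ^ Fintype.card ι * D * Fintype.card α)
        * ((2 * (d : ℝ) ^ 2 * Fintype.card F) ^ Fintype.card κ
          * (Fintype.card F : ℝ) ^ Fintype.card ι) := by
    rw [hsplit]
    calc ‖∑ u with u ≠ 0, T u * S u‖ ^ 2
        ≤ (∑ u with u ≠ 0, ‖T u‖ * ‖S u‖) ^ 2 := by
          gcongr
          exact (norm_sum_le _ _).trans_eq (by simp_rw [norm_mul])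
      _ ≤ (∑ u with u ≠ 0, ‖T u‖ ^ 2) * ∑ u with u ≠ 0, ‖S u‖ ^ 2 :=
          sum_mul_sq_le_sq_mul_sq _ _ _
      _ ≤ _ := by
          gcongr
          · exact (sum_le_univ_sum_of_nonneg fun u ↦ by positivity).trans
              (sum_norm_sq_sum_char_le hψ f D hf)
          · exact sum_norm_sq_prod_char_pow_le hψ B hB e d he0 he
  rcases Nat.eq_zero_or_pos (Fintype.card α) with h0 | hpos
  · rw [h0, Nat.cast_zero, zero_mul] at hlarge
    exact hlarge.not_ge (by positivity)
  have hpos' : (0 : ℝ) < Fintype.card α := by exact_mod_cast hpos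
  have := mul_lt_mul_of_pos_left hlarge hpos'
  rw [pow_mul' _ 2, pow_mul' _ 2] at this
  nlinarith

end CharacterSums

section Counting

/-- A zero-dimensional Bézout bound: the leading forms `x l ^ d l` have no common zero at
infinity. -/
theorem card_le_prod_of_pow_eq_eval {F ι : Type*} [Field F] [Fintype F] [Fintype ι]
    [DecidableEq ι] (d : ι → ℕ) (g : ι → MvPolynomial ι F) (hg : ∀ l, (g l).totalDegree < d l)
    (Z : Finset (ι → F)) (hZ : ∀ x ∈ Z, ∀ l, x l ^ d l = MvPolynomial.eval x (g l)) :
    #Z ≤ ∏ l, d l := by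
  classical
  set mono : (∀ l, Fin (d l)) → Z → F := fun e x ↦ ∏ l, x.1 l ^ (e l : ℕ)
  set W := Submodule.span F (Set.range mono) with hW
  have hsum (p : MvPolynomial ι F) : (fun x : Z ↦ MvPolynomial.eval x.1 p)
      = ∑ s ∈ p.support, p.coeff s • fun x : Z ↦ ∏ l, x.1 l ^ s l := by
    ext x
    simp [MvPolynomial.eval_eq']
  have hmem (N : ℕ) : ∀ s : ι →₀ ℕ, s.degree ≤ N → (fun x : Z ↦ ∏ l, x.1 l ^ s l) ∈ W := by
    induction N using Nat.strong_induction_on with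
    | _ N ih =>
    intro s hs
    by_cases hlt : ∀ l, s l < d l
    · exact Submodule.subset_span ⟨fun l ↦ ⟨s l, hlt l⟩, rfl⟩
    push Not at hlt
    obtain ⟨l, hl⟩ := hlt
    have hs' : s = Finsupp.single l (d l) + (s - Finsupp.single l (d l)) :=
      (add_tsub_cancel_of_le (Finsupp.single_le_iff.mpr hl)).symm
    set r := s - Finsupp.single l (d l)
    have hdeg : s.degree = d l + r.degree := by rw [hs']; simp
    have hfun : (fun x : Z ↦ ∏ i, x.1 i ^ s i)
        = fun x : Z ↦ MvPolynomial.eval x.1 (g l * MvPolynomial.monomial r 1) := by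
      ext x
      rw [map_mul, ← hZ x.1 x.2 l, MvPolynomial.eval_monomial, one_mul, hs',
        Finsupp.prod_fintype _ _ (by simp)]
      simp_rw [Finsupp.add_apply, pow_add, prod_mul_distrib]
      congr 1
      rw [prod_eq_single l (fun i _ hi ↦ by simp [Finsupp.single_eq_of_ne hi]) (by simp)]
      simp
    rw [hfun, hsum]
    refine Submodule.sum_mem _ fun v hv ↦ W.smul_mem _ (ih v.degree ?_ v le_rfl)
    have h1 := MvPolynomial.le_totalDegree hv
    have h2 := MvPolynomial.totalDegree_mul (g l) (MvPolynomial.monomial r 1)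
    have h3 := MvPolynomial.totalDegree_monomial_le r (1 : F)
    have h4 := hg l
    change v.degree ≤ _ at h1
    change _ ≤ r.degree at h3
    omega
  have htop : W = ⊤ := by
    refine (Submodule.eq_top_iff').mpr fun φ ↦ ?_
    have : φ = ∑ z : Z, φ z • fun x : Z ↦ MvPolynomial.eval x.1 (MvPolynomial.indicator z.1) := by
      ext x
      rw [Finset.sum_apply, sum_eq_single x]
      · simp [MvPolynomial.eval_indicator_apply_eq_one]
      · intro z _ hz
        simp [MvPolynomial.eval_indicator_apply_eq_zero x.1 z.1 fun h ↦ hz (Subtype.ext h.symm)]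
      · simp
    rw [this]
    refine Submodule.sum_mem _ fun z _ ↦ W.smul_mem _ ?_
    rw [hsum]
    exact Submodule.sum_mem _ fun v _ ↦ W.smul_mem _ (hmem _ v le_rfl)
  have hrank := finrank_range_le_card (R := F) mono
  rw [Set.finrank, ← hW, htop, finrank_top, Module.finrank_fintype_fun_eq_card] at hrank
  simpa using hrank

theorem card_ne_zero_orthogonal_mul_pow_le {F : Type*} [Field F] [Fintype F] [DecidableEq F]
    {n : ℕ} {κ : Type*} [Fintype κ] [DecidableEq κ] (B : κ → Fin n → F) (hn : n ≤ Fintype.card κ)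
    (hB : ∀ φ : Fin n ↪ κ, (Matrix.of fun i j ↦ B (φ j) i).det ≠ 0) (L : Finset κ) :
    #{u : Fin n → F | u ≠ 0 ∧ ∀ l ∈ L, u ⬝ᵥ B l = 0} * Fintype.card F ^ #L
      ≤ Fintype.card F ^ n := by
  have hinj (φ : Fin n ↪ κ) {u : Fin n → F} (hu : ∀ i, u ⬝ᵥ B (φ i) = 0) : u = 0 :=
    Matrix.eq_zero_of_vecMul_eq_zero (hB φ) (funext hu)
  rcases le_total n #L with hL | hL
  · obtain ⟨L', hL', hcard⟩ := exists_subset_card_eq hL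
    set φ : Fin n ↪ κ := (L'.equivFinOfCardEq hcard).symm.toEmbedding.trans (.subtype _)
    rw [filter_eq_empty_iff.mpr]
    · simp
    · rintro u - ⟨hu0, hu⟩
      exact hu0 (hinj φ fun i ↦ hu _ (hL' (Subtype.prop _)))
  · obtain ⟨L', hL', -, hcard⟩ := exists_subsuperset_card_eq (subset_univ L) hL hn
    set φ : Fin n ↪ κ := (L'.equivFinOfCardEq hcard).symm.toEmbedding.trans (.subtype _) with hφ
    have hsurj (l : κ) (hl : l ∈ L) : ∃ i, φ i = l :=
      ⟨L'.equivFinOfCardEq hcard ⟨l, hL' hl⟩, by simp [hφ]⟩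
    have := Fintype.card_le_of_injective
      (α := {u : Fin n → F // u ≠ 0 ∧ ∀ l ∈ L, u ⬝ᵥ B l = 0} × (L → F)) (β := Fin n → F)
      (fun p i ↦ if h : φ i ∈ L then p.2 ⟨φ i, h⟩ else p.1.1 ⬝ᵥ B (φ i)) ?_
    · simpa [Fintype.card_subtype] using this
    · rintro ⟨⟨u, hu0, hu⟩, w⟩ ⟨⟨u', hu0', hu'⟩, w'⟩ h
      have huu : u - u' = 0 := hinj φ fun i ↦ by
        rw [sub_dotProduct, sub_eq_zero]
        by_cases hi : φ i ∈ L
        · rw [hu _ hi, hu' _ hi]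
        · simpa [hi] using congrFun h i
      have hww : w = w' := by
        ext ⟨l, hl⟩
        obtain ⟨i, rfl⟩ := hsurj l hl
        simpa [hl] using congrFun h i
      obtain rfl := sub_eq_zero.mp huu
      rw [hww]

theorem card_units_diagonal_system_le {F : Type*} [Field F] [Fintype F] [DecidableEq F] {n : ℕ}
    (M : Matrix (Fin n) (Fin n) F) (hM : M.det ≠ 0) (d : Fin n → ℕ) (c : Fin n → Fin n → ℕ)
    (hcd : ∀ j l, ∑ i, c j i < d l) (a b v : Fin n → F) :
    #{x : Fin n → Fˣ | (fun j ↦ ∑ l, M j l * (x l : F) ^ d l + a j - b j * ∏ l, (x l : F) ^ c j l)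
      = v} ≤ ∏ l, d l := by
  classical
  set p : Fin n → MvPolynomial (Fin n) F := fun j ↦
    MvPolynomial.monomial (Finsupp.equivFunOnFinite.symm (c j)) (b j)
      + MvPolynomial.C (v j - a j) with hp
  have hpdeg (j : Fin n) : (p j).totalDegree ≤ ∑ i, c j i := by
    refine (MvPolynomial.totalDegree_add _ _).trans (max_le ?_ ?_)
    swap
    · exact (MvPolynomial.totalDegree_C _).trans_le (Nat.zero_le _)
    refine (MvPolynomial.totalDegree_monomial_le _ _).trans_eq ?_
    rw [Finsupp.sum_fintype _ _ (by simp)]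
    simp
  have heval (x : Fin n → F) (j : Fin n) :
      MvPolynomial.eval x (p j) = b j * ∏ l, x l ^ c j l + (v j - a j) := by
    rw [hp, map_add, MvPolynomial.eval_monomial, Finsupp.prod_fintype _ _ (by simp)]
    simp
  set g : Fin n → MvPolynomial (Fin n) F := fun l ↦ ∑ j, MvPolynomial.C (M⁻¹ l j) * p j with hg
  have hgdeg (l : Fin n) : (g l).totalDegree < d l := by
    refine (MvPolynomial.totalDegree_finsetSum_le (d := d l - 1) fun j _ ↦ ?_).trans_lt ?_
    · have h1 := MvPolynomial.totalDegree_mul (MvPolynomial.C (M⁻¹ l j)) (p j)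
      rw [MvPolynomial.totalDegree_C] at h1
      have := hpdeg j
      have := hcd j l
      omega
    · have := hcd l l
      omega
  set Z : Finset (Fin n → Fˣ) := {x : Fin n → Fˣ | (fun j ↦ ∑ l, M j l * (x l : F) ^ d l + a j
    - b j * ∏ l, (x l : F) ^ c j l) = v}
  rw [← card_image_of_injective Z (f := fun x l ↦ (x l : F))
    fun x y h ↦ funext fun l ↦ Units.ext (congrFun h l)]
  refine card_le_prod_of_pow_eq_eval d g hgdeg _ fun z hz l ↦ ?_
  obtain ⟨x, hx, rfl⟩ := mem_image.mp hz
  have hsys : M.mulVec (fun l ↦ (x l : F) ^ d l)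
      = fun j ↦ MvPolynomial.eval (fun l ↦ (x l : F)) (p j) := by
    ext j
    have := congrFun (mem_filter.mp hx).2 j
    rw [heval, ← this]
    simp only [Matrix.mulVec, dotProduct]
    ring
  have hinv := congrArg M⁻¹.mulVec hsys
  rw [Matrix.mulVec_mulVec, Matrix.nonsing_inv_mul _ (isUnit_iff_ne_zero.mpr hM),
    Matrix.one_mulVec] at hinv
  simpa [hg, Matrix.mulVec, dotProduct] using congrFun hinv l

theorem main_term_gt_error_of_rpow_lt {n k d : ℕ} {q : ℝ} (hn : 0 < n) (hk : 0 < k) (hd : 0 < d)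
    (hq : 2 ≤ q) (h : ((30 * n * d : ℕ) : ℝ)
      ^ ((2 * ((n + (n + k) : ℕ) : ℝ) + 2) / (((n + (n + k) : ℕ) : ℝ) - 2 * n)) < q) :
    q ^ (2 * n) * (d : ℝ) ^ n * (2 * (d : ℝ) ^ 2 * q) ^ (n + k)
      < (q - 1) ^ n * (q - 1) ^ (2 * (n + k)) := by
  set K : ℝ := ((30 * n * d : ℕ) : ℝ) with hK
  have hd1 : (1 : ℝ) ≤ d := by exact_mod_cast hd
  have hn1 : (1 : ℝ) ≤ n := by exact_mod_cast hn
  have hKd : 30 * (d : ℝ) ≤ K := by rw [hK]; push_cast; nlinarith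
  have hpow : K ^ (2 * (2 * n + k) + 2) < q ^ k := by
    have hk' : (0 : ℝ) < k := by exact_mod_cast hk
    have h2 := Real.rpow_lt_rpow (by positivity) h hk'
    rw [← Real.rpow_mul (by positivity), Real.rpow_natCast] at h2
    convert h2 using 1
    rw [← Real.rpow_natCast]
    congr 1
    push_cast
    rw [show (n + (n + k) : ℝ) - 2 * n = k by ring, div_mul_cancel₀ _ hk'.ne']
    ring
  have hconst : (2 : ℝ) ^ (3 * n + 2 * k) * (2 ^ (n + k) * (d : ℝ) ^ (3 * n + 2 * k))
      ≤ K ^ (2 * (2 * n + k) + 2) := by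
    calc (2 : ℝ) ^ (3 * n + 2 * k) * (2 ^ (n + k) * (d : ℝ) ^ (3 * n + 2 * k))
        ≤ 2 ^ (3 * n + 2 * k) * (2 ^ (3 * n + 2 * k) * (d : ℝ) ^ (3 * n + 2 * k)) := by
          gcongr
          · norm_num
          · omega
          · omega
      _ = (4 * d) ^ (3 * n + 2 * k) := by
          rw [mul_pow, ← mul_assoc, ← mul_pow]
          norm_num
      _ ≤ K ^ (3 * n + 2 * k) := by
          gcongr
          linarith
      _ ≤ _ := pow_le_pow_right₀ (by linarith) (by omega)
  have hlt : (2 : ℝ) ^ (3 * n + 2 * k)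
        * (q ^ (2 * n) * (d : ℝ) ^ n * (2 * (d : ℝ) ^ 2 * q) ^ (n + k))
      < 2 ^ (3 * n + 2 * k) * ((q - 1) ^ n * (q - 1) ^ (2 * (n + k))) := by
    calc (2 : ℝ) ^ (3 * n + 2 * k)
          * (q ^ (2 * n) * (d : ℝ) ^ n * (2 * (d : ℝ) ^ 2 * q) ^ (n + k))
        = q ^ (3 * n + k) * (2 ^ (3 * n + 2 * k) * (2 ^ (n + k) * (d : ℝ) ^ (3 * n + 2 * k))) := by
          ring
      _ ≤ q ^ (3 * n + k) * K ^ (2 * (2 * n + k) + 2) := by gcongr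
      _ < q ^ (3 * n + k) * q ^ k := by gcongr
      _ = q ^ (3 * n + 2 * k) := by ring
      _ ≤ (2 * (q - 1)) ^ (3 * n + 2 * k) := by
          gcongr
          linarith
      _ = _ := by rw [mul_pow]; ring
  exact lt_of_mul_lt_mul_left hlt (by positivity)

end Counting


/-- existence of a solution with all coordinates nonzero of a
system of generalized Markoff–Hurwitz-type equations when q is large enough. -/
theorem markoff_hurwitz_system_nonzero_solution_existence
    (q t n : ℕ) (hq : IsPrimePow q)
    (F : Type*) [Field F] [Fintype F] (hFq : Fintype.card F = q)
    (ht : 0 < t) (hn : 0 < n) (hnt : 2 * n + 2 ≤ t) (hnt' : n ≤ t)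
    (d : Fin t → ℕ) (hd : StrictAnti d) (hd2 : ∀ i, 2 ≤ d i)
    (hchar : ∀ i, ¬ (ringChar F ∣ d i))
    (A : Matrix (Fin n) (Fin t) F)
    (hH : ∀ φ : Fin n ↪ Fin t, (A.submatrix id φ).det ≠ 0)
    (c : Fin n → Fin n → ℕ) (hc : ∀ j l, 0 < c j l)
    (hcd : ∀ j, ∑ l, c j l < d ⟨t - 1, Nat.sub_lt ht Nat.one_pos⟩)
    (a : Fin n → F) (ha : ∃ j, a j ≠ 0)
    (b : Fin n → F) (hb : ∀ j, b j ≠ 0)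
    (hqbig : ((30 * n * d ⟨0, ht⟩ : ℕ) : ℝ)
          ^ ((2 * (t : ℝ) + 2) / ((t : ℝ) - 2 * n)) < (q : ℝ)) :
    ∃ x : Fin t → F, (∀ j, x j ≠ 0) ∧
      ∀ j, ∑ l, A j l * x l ^ d l + a j
        = b j * ∏ l : Fin n, x (Fin.castLE hnt' l) ^ c j l := by
  classical
  obtain ⟨k, rfl⟩ : ∃ k, t = n + (n + k) := ⟨t - 2 * n, by omega⟩
  set D := d ⟨0, ht⟩
  have hdD (i : Fin (n + (n + k))) : d i ≤ D := hd.antitone (Fin.mk_le_mk.mpr (Nat.zero_le _))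
  have hd0 (i : Fin (n + (n + k))) : 0 < d i := two_pos.trans_le (hd2 i)
  set f : (Fin n → Fˣ) → Fin n → F := fun x j ↦
    ∑ l, A j (Fin.castAdd (n + k) l) * (x l : F) ^ d (Fin.castAdd (n + k) l) + a j
      - b j * ∏ l, (x l : F) ^ c j l with hf
  set B : Fin (n + k) → Fin n → F := fun l j ↦ A j (Fin.natAdd n l) with hB
  have hfiber (v : Fin n → F) : #{x | f x = v} ≤ D ^ n := by
    refine (card_units_diagonal_system_le (A.submatrix id (Fin.castAdd (n + k)))
      (hH (Fin.castAddEmb (n + k))) (fun l ↦ d (Fin.castAdd (n + k) l)) c (fun j l ↦ ?_)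
      a b v).trans ?_
    · exact (hcd j).trans_le (hd.antitone (Fin.le_def.mpr (by simp only [Fin.val_castAdd]; omega)))
    · exact (prod_le_pow_card _ _ _ fun l _ ↦ hdD _).trans_eq (by simp)
  have hq2 : 2 ≤ Fintype.card F := Fintype.one_lt_card
  have hunits : (Fintype.card Fˣ : ℝ) = Fintype.card F - 1 := by
    rw [Fintype.card_units, Nat.cast_sub (by omega), Nat.cast_one]
  have hlarge := main_term_gt_error_of_rpow_lt hn (by omega) (hd0 ⟨0, ht⟩)
    (by rw [← hFq]; exact_mod_cast hq2) hqbig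
  obtain ⟨x, y, hxy⟩ := exists_add_sum_units_pow_smul_eq_zero f (D ^ n) hfiber B
    (by
      simpa using card_ne_zero_orthogonal_mul_pow_le B (by simp)
        fun φ ↦ hH (φ.trans (Fin.natAddEmb n)))
    (fun l ↦ d (Fin.natAdd n l)) D (fun l ↦ hd0 _) (fun l ↦ hdD _)
    (by
      rw [Fintype.card_fun, Nat.cast_pow, Nat.cast_pow, hunits, hFq, Fintype.card_fin,
        Fintype.card_fin]
      exact hlarge)
  set z : Fin (n + (n + k)) → F := Fin.append (fun l ↦ (x l : F)) fun l ↦ (y l : F)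
  have hzl (l : Fin n) : z (Fin.castAdd (n + k) l) = x l := Fin.append_left _ _ l
  have hzr (l : Fin (n + k)) : z (Fin.natAdd n l) = y l := Fin.append_right _ _ l
  have hcast (l : Fin n) : Fin.castLE hnt' l = Fin.castAdd (n + k) l := rfl
  refine ⟨z, fun j ↦ ?_, fun j ↦ ?_⟩
  · refine Fin.addCases (fun l ↦ ?_) (fun l ↦ ?_) j <;> simp [hzl, hzr]
  · have hj := congrFun hxy j
    simp only [hf, hB, Pi.add_apply, Finset.sum_apply, Pi.smul_apply, smul_eq_mul,
      Pi.zero_apply] at hj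
    rw [Fin.sum_univ_add]
    simp only [hcast, hzl, hzr, mul_comm (A j (Fin.natAdd n _))]
    linear_combination hj
end
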